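/- Let G be a finite simple bipartite graph on n vertices that is 4k-intercyclic, i.e., G contains no two vertex-disjoint cycles each of length divisible by 4. Then π(G,x) = φ_p(G,x) + 4 Σ_{R ∈ C_{4k}(G)} φ_p(G∖R, x), where C_{4k}(G) denotes the set of all cycles of G whose length is divisible by 4, and G∖R is the induced subgraph of G obtained by deleting the vertices of R. -/

import Mathlib

open Polynomial SimpleGraph
open scoped Classical

noncomputable section

/-- The adjacency matrix of a simple graph `G`, with entries in `R`. -/
def adjMat (R : Type*) [Zero R] [One R] {V : Type*} [Fintype V] (G : SimpleGraph V) :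
    Matrix V V R := fun u v => if G.Adj u v then 1 else 0

/-- The characteristic polynomial `det (xI - A(G))` of a simple graph `G`. -/
def charPolyG (R : Type*) [CommRing R] {V : Type*} [Fintype V] (G : SimpleGraph V) : R[X] :=
  (adjMat R G).charpoly

/-- The permanental polynomial `per (xI - A(G))` of a simple graph `G`. -/
def permPolyG (R : Type*) [CommRing R] {V : Type*} [Fintype V] (G : SimpleGraph V) : R[X] :=
  (Matrix.charmatrix (adjMat R G)).permanent

/-- The modified characteristic polynomial `φ_p(G,x) = ∑_{i even} (-1)^{i/2} a_i x^{n-i}`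
of a (bipartite) graph `G` on `n` vertices, where `a_i` is the coefficient of `x^{n-i}`
in the characteristic polynomial. -/
def phiP {V : Type*} [Fintype V] (G : SimpleGraph V) : ℝ[X] :=
  ∑ i ∈ Finset.range (Fintype.card V + 1),
    if Even i then
      C ((-1 : ℝ) ^ (i / 2) * (charPolyG ℝ G).coeff (Fintype.card V - i)) *
        X ^ (Fintype.card V - i)
    else 0

/-- `G` contains no cycle whose length is divisible by 4. -/
def C4kFree {V : Type*} (G : SimpleGraph V) : Prop :=
  ¬ ∃ (v : V) (c : G.Walk v v), c.IsCycle ∧ 4 ∣ c.length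

/-- `G` is `4k`-intercyclic: it contains no two vertex-disjoint cycles,
each of length divisible by 4. -/
def Intercyclic4k {V : Type*} (G : SimpleGraph V) : Prop :=
  ¬ ∃ (u v : V) (c : G.Walk u u) (d : G.Walk v v),
      c.IsCycle ∧ d.IsCycle ∧ 4 ∣ c.length ∧ 4 ∣ d.length ∧
      ∀ x, x ∈ c.support → x ∉ d.support

/-- A subgraph `R` of `G` is a cycle of `G` if it is the subgraph traced by some cycle walk. -/
def IsCycleSubgraph {V : Type*} (G : SimpleGraph V) (R : G.Subgraph) : Prop :=
  ∃ (v : V) (c : G.Walk v v), c.IsCycle ∧ R = c.toSubgraph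

/-- The set of all `4k`-cycles (cycles of length divisible by 4) of `G`,
viewed as subgraphs. -/
def cycles4k {V : Type*} (G : SimpleGraph V) : Set G.Subgraph :=
  {R | ∃ (v : V) (c : G.Walk v v), c.IsCycle ∧ 4 ∣ c.length ∧ R = c.toSubgraph}

/-- The connected component `c` of the subgraph `H` is a single edge (a `K₂`). -/
def IsEdgeComp {V : Type*} {G : SimpleGraph V} (H : G.Subgraph)
    (c : H.coe.ConnectedComponent) : Prop :=
  ∃ x y : H.verts, H.coe.Adj x y ∧ c.supp = {x, y}

/-- The connected component `c` of the subgraph `H` is a cycle: there is a cycle walk whose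
support is exactly `c` and which uses every edge of `H` inside `c`. -/
def IsCycleComp {V : Type*} {G : SimpleGraph V} (H : G.Subgraph)
    (c : H.coe.ConnectedComponent) : Prop :=
  ∃ (v : H.verts) (w : H.coe.Walk v v), w.IsCycle ∧
    {x | x ∈ w.support} = c.supp ∧
    ∀ x y : H.verts, H.coe.Adj x y → x ∈ c.supp → w.toSubgraph.Adj x y

/-- A Sachs subgraph of `G`: a subgraph each of whose connected components is either
a single edge or a cycle. -/
def IsSachs {V : Type*} {G : SimpleGraph V} (H : G.Subgraph) : Prop :=
  ∀ c : H.coe.ConnectedComponent, IsEdgeComp H c ∨ IsCycleComp H c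

/-- The number of connected components of the subgraph `H`. -/
def pCount {V : Type*} {G : SimpleGraph V} (H : G.Subgraph) : ℕ :=
  Nat.card H.coe.ConnectedComponent

/-- The number of components of `H` that are cycles of length divisible by 4. -/
def sCount {V : Type*} {G : SimpleGraph V} (H : G.Subgraph) : ℕ :=
  Set.ncard {c : H.coe.ConnectedComponent | IsCycleComp H c ∧ c.supp.ncard % 4 = 0}

/-- The number of components of `H` that are cycles of length congruent to 2 mod 4. -/
def tCount {V : Type*} {G : SimpleGraph V} (H : G.Subgraph) : ℕ :=
  Set.ncard {c : H.coe.ConnectedComponent | IsCycleComp H c ∧ c.supp.ncard % 4 = 2}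

/-- The number of components of `H` that are cycles. -/
def cycCount {V : Type*} {G : SimpleGraph V} (H : G.Subgraph) : ℕ :=
  Set.ncard {c : H.coe.ConnectedComponent | IsCycleComp H c}

/-- `R` is a union of connected components of `H`. -/
def IsComponentUnion {V : Type*} {G : SimpleGraph V} (R H : G.Subgraph) : Prop :=
  R ≤ H ∧ ∀ x y, H.Adj x y → x ∈ R.verts → R.Adj x y


/-- A permutation that moves every vertex it does not fix along an edge of `G`. -/
def IsGraphPerm {V : Type*} (G : SimpleGraph V) (σ : Equiv.Perm V) : Prop :=
  ∀ v, σ v = v ∨ G.Adj v (σ v)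

/-- The subgraph of `G` on the non-fixed vertices of `c` whose edges join `v` to `c v`. -/
def permSubgraph {V : Type*} (G : SimpleGraph V) (c : Equiv.Perm V) : G.Subgraph where
  verts := {v | c v ≠ v}
  Adj u v := G.Adj u v ∧ (c u = v ∨ c v = u)
  adj_sub h := h.1
  edge_vert := by
    rintro u v ⟨h, rfl | rfl⟩
    · exact h.ne'
    · exact fun h' => h.ne (c.injective h')
  symm := ⟨fun _ _ h => ⟨h.1.symm, h.2.symm⟩⟩

/-- The cyclic permutations of `V` that run through a cycle of `G` of length divisible by 4. -/
def IsCyclePerm4k {V : Type*} [Fintype V] [DecidableEq V] (G : SimpleGraph V)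
    (c : Equiv.Perm V) : Prop :=
  IsGraphPerm G c ∧ c.IsCycle ∧ 4 ∣ c.support.card

section CyclePerm

variable {V : Type*} {G : SimpleGraph V}

lemma IsGraphPerm.inv {σ : Equiv.Perm V} (h : IsGraphPerm G σ) : IsGraphPerm G σ⁻¹ := by
  intro v
  rcases h (σ⁻¹ v) with h | h
  · left; simpa using h.symm
  · right; simpa using h.symm

lemma permSubgraph_inv (c : Equiv.Perm V) : permSubgraph G c⁻¹ = permSubgraph G c := by
  ext u v
  · simp only [permSubgraph, Set.mem_ofPred_eq, ne_eq, Equiv.Perm.inv_eq_iff_eq, eq_comm (a := u)]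
  · simp only [permSubgraph, Equiv.Perm.inv_eq_iff_eq]
    rw [or_comm, eq_comm (a := v), eq_comm (a := u)]

lemma permSubgraph_adj_apply {c : Equiv.Perm V} (hc : IsGraphPerm G c) {v : V} (hv : c v ≠ v) :
    (permSubgraph G c).Adj v (c v) :=
  ⟨(hc v).resolve_left hv, Or.inl rfl⟩

/-- A graph permutation gives walks along its orbits. -/
lemma IsGraphPerm.exists_walk {c : Equiv.Perm V} (hc : IsGraphPerm G c) (n : ℕ) :
    ∀ v w : V, c v ≠ v → (c ^ n) v = w →
      ∃ p : G.Walk v w, p.length = n ∧ ∀ i ≤ n, p.getVert i = (c ^ i) v := by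
  induction n with
  | zero =>
    intro v w _ hw
    obtain rfl : v = w := by simpa using hw
    exact ⟨Walk.nil, rfl, by simp⟩
  | succ n ih =>
    intro v w hv hw
    obtain ⟨p, hp, hpi⟩ := ih (c v) w (fun h => hv (c.injective h)) (by
      rw [← hw, pow_succ]; rfl)
    refine ⟨Walk.cons ((hc v).resolve_left hv) p, by simp [hp], ?_⟩
    rintro (_ | i) hi
    · simp
    · rw [Walk.getVert_cons_succ, hpi i (by omega), pow_succ]; rfl

lemma disjoint_ofSubtype (c : Equiv.Perm V) (s : Set V) [DecidablePred (· ∈ s)]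
    (hs : s = {v | c v = v}) (τ : Equiv.Perm s) : c.Disjoint (Equiv.Perm.ofSubtype τ) := by
  intro v
  by_cases hv : c v = v
  · exact Or.inl hv
  · exact Or.inr (Equiv.Perm.ofSubtype_apply_of_not_mem τ (by rw [hs]; exact hv))

lemma isGraphPerm_ofSubtype {s : Set V} [DecidablePred (· ∈ s)] {τ : Equiv.Perm s}
    (h : IsGraphPerm (G.induce s) τ) : IsGraphPerm G (Equiv.Perm.ofSubtype τ) := by
  intro v
  by_cases hv : v ∈ s
  · rw [Equiv.Perm.ofSubtype_apply_of_mem τ hv]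
    exact (h ⟨v, hv⟩).imp (congrArg Subtype.val) id
  · exact Or.inl (Equiv.Perm.ofSubtype_apply_of_not_mem τ hv)

variable [Fintype V] [DecidableEq V]

lemma IsCyclePerm4k.inv {c : Equiv.Perm V} (h : IsCyclePerm4k G c) : IsCyclePerm4k G c⁻¹ :=
  ⟨h.1.inv, h.2.1.inv, by simpa using h.2.2⟩

lemma IsCyclePerm4k.four_le {c : Equiv.Perm V} (h : IsCyclePerm4k G c) : 4 ≤ c.support.card :=
  Nat.le_of_dvd (by have := h.2.1.two_le_card_support; omega) h.2.2

lemma IsCyclePerm4k.apply_apply_ne {c : Equiv.Perm V} (h : IsCyclePerm4k G c) {v : V}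
    (hv : c v ≠ v) : c (c v) ≠ v := by
  intro h2
  have h3 : c ^ 2 = 1 := (h.2.1.pow_eq_one_iff' hv).2 (by simpa [pow_two] using h2)
  have h4 := Nat.le_of_dvd (by norm_num) (orderOf_dvd_of_pow_eq_one h3)
  rw [h.2.1.orderOf] at h4
  have := h.four_le
  omega

lemma IsCyclePerm4k.ne_inv {c : Equiv.Perm V} (h : IsCyclePerm4k G c) : c ≠ c⁻¹ := by
  obtain ⟨v, hv, -⟩ := h.2.1
  intro h'
  apply h.apply_apply_ne hv
  conv_lhs => rw [h']
  rw [Equiv.Perm.inv_eq_iff_eq, ← h']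

/-- A cyclic graph permutation of length divisible by 4 is traced by a cycle of `G`. -/
lemma IsCyclePerm4k.exists_walk {c : Equiv.Perm V} (h : IsCyclePerm4k G c) :
    ∃ (v : V) (w : G.Walk v v), w.IsCycle ∧ 4 ∣ w.length ∧ permSubgraph G c = w.toSubgraph := by
  obtain ⟨hg, hc, h4⟩ := h
  have h4' := IsCyclePerm4k.four_le ⟨hg, hc, h4⟩
  obtain ⟨v, hv, -⟩ := id hc
  have ho := hc.orderOf
  obtain ⟨p, hp, hpi⟩ := hg.exists_walk c.support.card v v hv (by
    rw [← ho, pow_orderOf_eq_one]; rfl)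
  have hinj : ∀ i < c.support.card, ∀ j < c.support.card, (c ^ i) v = (c ^ j) v → i = j := by
    intro i hi j hj hij
    wlog hlt : i ≤ j generalizing i j
    · exact (this j hj i hi hij.symm (by omega)).symm
    have h1 : (c ^ (j - i)) v = v := by
      apply (c ^ i).injective
      rw [← Equiv.Perm.mul_apply, ← pow_add, hij]
      congr 2; omega
    have h2 := Nat.eq_zero_of_dvd_of_lt
      (orderOf_dvd_of_pow_eq_one ((hc.pow_eq_one_iff' hv).2 h1)) (by omega)
    omega
  have hgv : ∀ x, c x ≠ x ↔ ∃ i < c.support.card, (c ^ i) v = x := by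
    intro x
    constructor
    · intro hx
      obtain ⟨i, hi⟩ := hc.exists_pow_eq hv hx
      refine ⟨i % orderOf c, ho ▸ Nat.mod_lt _ (by omega), by rwa [pow_mod_orderOf]⟩
    · rintro ⟨i, -, rfl⟩
      rw [← Equiv.Perm.mem_support, Equiv.Perm.pow_apply_mem_support]
      simpa using hv
  refine ⟨v, p, ?_, hp ▸ h4, ?_⟩
  · rw [Walk.isCycle_iff_isPath_tail_and_le_length]
    refine ⟨?_, by omega⟩
    rw [← Walk.IsPath.getVert_injOn_iff]
    intro i hi j hj hij
    have hnn : ¬ p.Nil := by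
      intro hn
      have := Walk.length_eq_zero_iff.2 hn
      omega
    have hl := Walk.length_tail_add_one hnn
    simp only [Set.mem_ofPred_eq] at hi hj
    rw [Walk.getVert_tail, Walk.getVert_tail, hpi _ (by omega), hpi _ (by omega), pow_succ',
      pow_succ'] at hij
    exact hinj i (by omega) j (by omega) (c.injective hij)
  · ext x y
    · rw [Walk.mem_verts_toSubgraph, Walk.mem_support_iff_exists_getVert]
      change c x ≠ x ↔ _
      rw [hgv]
      constructor
      · rintro ⟨i, hi, h⟩
        exact ⟨i, by rw [hpi i hi.le, h], by omega⟩
      · rintro ⟨i, h, hi⟩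
        rw [hpi i (by omega)] at h
        rw [hp] at hi
        rcases hi.lt_or_eq with hi | rfl
        · exact ⟨i, hi, h⟩
        · refine ⟨0, by omega, ?_⟩
          rw [← h, ← ho, pow_orderOf_eq_one, pow_zero]
    · have key : ∀ x y, G.Adj x y → c x = y →
          ∃ i, s(p.getVert i, p.getVert (i + 1)) = s(x, y) ∧ i < p.length := by
        rintro x y hxy rfl
        obtain ⟨i, hi, h⟩ := (hgv x).1 hxy.ne'
        refine ⟨i, ?_, by omega⟩
        rw [hpi _ hi.le, hpi _ (by omega), pow_succ', Equiv.Perm.mul_apply, h]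
      constructor
      · rintro ⟨hxy, h | h⟩
        · exact (Walk.toSubgraph_adj_iff p).2 (key x y hxy h)
        · exact ((Walk.toSubgraph_adj_iff p).2 (key y x hxy.symm h)).symm
      · intro h
        refine ⟨h.adj_sub, ?_⟩
        obtain ⟨i, h, hi⟩ := (Walk.toSubgraph_adj_iff p).1 h
        rw [hpi _ (by omega), hpi _ (by omega), pow_succ', Equiv.Perm.mul_apply] at h
        rcases Sym2.eq_iff.1 h with ⟨h1, h2⟩ | ⟨h1, h2⟩
        · left; rw [← h1, h2]
        · right; rw [← h1, h2]

/-- Every cycle of `G` of length divisible by 4 is traced by a cyclic graph permutation. -/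
lemma exists_isCyclePerm4k_of_isCycle {v : V} {w : G.Walk v v} (hw : w.IsCycle)
    (h4 : 4 ∣ w.length) : ∃ c, IsCyclePerm4k G c ∧ permSubgraph G c = w.toSubgraph := by
  set l := w.support.tail with hl
  have hnd : l.Nodup := hw.support_nodup
  have hlen : l.length = w.length := by simp [hl]
  have h3 := hw.three_le_length
  have hget : ∀ i (hi : i < l.length), l[i] = w.getVert (i + 1) := by
    intro i hi
    simp [hl, List.getElem_tail, Walk.support_getElem_eq_getVert]
  have hc : ∀ i < w.length, l.formPerm (w.getVert i) = w.getVert (i + 1) := by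
    rintro (_ | i) hi
    · have h := List.formPerm_apply_getElem l hnd (w.length - 1) (by omega)
      rw [hget, hget, hlen, Nat.sub_add_cancel (by omega), Nat.mod_self, Walk.getVert_length] at h
      rw [Walk.getVert_zero]; exact h
    · have h := List.formPerm_apply_getElem l hnd i (by omega)
      rw [hget, hget, hlen, Nat.mod_eq_of_lt hi] at h
      exact h
  have hsupp : l.formPerm.support = l.toFinset := by
    apply List.support_formPerm_of_nodup l hnd
    intro x hx
    rw [hx] at hlen
    simp at hlen
    omega
  have hmem : ∀ x, l.formPerm x ≠ x ↔ x ∈ w.support := by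
    intro x
    rw [← Equiv.Perm.mem_support, hsupp, List.mem_toFinset]
    constructor
    · exact List.mem_of_mem_tail
    · intro hx
      rw [← Walk.cons_tail_support, List.mem_cons] at hx
      rcases hx with rfl | hx
      · exact Walk.end_mem_tail_support hw.not_nil
      · exact hx
  have hidx : ∀ x, l.formPerm x ≠ x → ∃ i < w.length, w.getVert i = x := by
    intro x hx
    obtain ⟨i, h, hi⟩ := Walk.mem_support_iff_exists_getVert.1 ((hmem x).1 hx)
    rcases hi.lt_or_eq with hi | rfl
    · exact ⟨i, hi, h⟩
    · exact ⟨0, by omega, by rw [← h]; simp⟩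
  refine ⟨l.formPerm, ⟨?_, List.isCycle_formPerm hnd (by omega), ?_⟩, ?_⟩
  · intro x
    by_cases hx : l.formPerm x = x
    · exact Or.inl hx
    · right
      obtain ⟨i, hi, rfl⟩ := hidx x hx
      rw [hc i hi]
      exact w.adj_getVert_succ hi
  · rw [hsupp, List.toFinset_card_of_nodup hnd, hlen]; exact h4
  · ext x y
    · rw [Walk.mem_verts_toSubgraph]
      exact hmem x
    · have key : ∀ x y, G.Adj x y → l.formPerm x = y →
          ∃ i, s(w.getVert i, w.getVert (i + 1)) = s(x, y) ∧ i < w.length := by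
        rintro x y hxy rfl
        obtain ⟨i, hi, rfl⟩ := hidx x hxy.ne'
        exact ⟨i, by rw [hc i hi], hi⟩
      constructor
      · rintro ⟨hxy, h | h⟩
        · exact (Walk.toSubgraph_adj_iff w).2 (key x y hxy h)
        · exact ((Walk.toSubgraph_adj_iff w).2 (key y x hxy.symm h)).symm
      · intro h
        refine ⟨h.adj_sub, ?_⟩
        obtain ⟨i, h, hi⟩ := (Walk.toSubgraph_adj_iff w).1 h
        rw [← hc i hi] at h
        rcases Sym2.eq_iff.1 h with ⟨h1, h2⟩ | ⟨h1, h2⟩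
        · left; rw [← h1, h2]
        · right; rw [← h1, h2]

lemma IsCyclePerm4k.eq_of_permSubgraph_eq_of_apply_eq {c d : Equiv.Perm V}
    (hc : IsCyclePerm4k G c) (hd : IsCyclePerm4k G d) (h : permSubgraph G d = permSubgraph G c)
    {v : V} (hv : c v ≠ v) (hdv : d v = c v) : d = c := by
  have hverts : ∀ x, d x ≠ x ↔ c x ≠ x := fun x => by
    have := congrArg (fun R : G.Subgraph => x ∈ R.verts) h
    exact iff_of_eq this
  have hstep : ∀ x, c x ≠ x → d x = c x → d (c x) = c (c x) := by
    intro x hx hdx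
    have hcx : d (c x) ≠ c x := (hverts _).2 fun h => hx (c.injective h)
    have hadj := permSubgraph_adj_apply hd.1 hcx
    rw [h] at hadj
    rcases hadj.2 with h' | h'
    · exact h'.symm
    · have h'' : d (c x) = x := c.injective h'
      rw [← hdx] at h''
      exact absurd h'' (hd.apply_apply_ne ((hverts x).2 hx))
  have hpow : ∀ n : ℕ, d ((c ^ n) v) = c ((c ^ n) v) := by
    intro n
    induction n with
    | zero => simpa using hdv
    | succ n ih =>
      rw [pow_succ', Equiv.Perm.mul_apply]
      refine hstep _ ?_ ih
      rw [← Equiv.Perm.mem_support, Equiv.Perm.pow_apply_mem_support]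
      simpa using hv
  ext x
  by_cases hx : c x = x
  · rw [hx]; exact not_not.1 fun h => (hverts x).1 h hx
  · obtain ⟨n, rfl⟩ := hc.2.1.exists_pow_eq hv hx
    exact hpow n

/-- A cycle is traced by exactly two cyclic permutations, inverse to each other. -/
lemma IsCyclePerm4k.permSubgraph_eq_iff {c d : Equiv.Perm V} (hc : IsCyclePerm4k G c)
    (hd : IsCyclePerm4k G d) :
    permSubgraph G d = permSubgraph G c ↔ d = c ∨ d = c⁻¹ := by
  constructor
  · intro h
    obtain ⟨v, hv, -⟩ := id hc.2.1
    have hdv : d v ≠ v := by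
      have := congrArg (fun R : G.Subgraph => v ∈ R.verts) h
      exact (iff_of_eq this).2 hv
    have hadj := permSubgraph_adj_apply hd.1 hdv
    rw [h] at hadj
    rcases hadj.2 with h' | h'
    · exact Or.inl (hc.eq_of_permSubgraph_eq_of_apply_eq hd h hv h'.symm)
    · right
      refine hc.inv.eq_of_permSubgraph_eq_of_apply_eq (v := v) hd
        (h.trans (permSubgraph_inv c).symm) ?_ ?_
      · rwa [Ne, Equiv.Perm.inv_eq_iff_eq, eq_comm]
      · rw [eq_comm, Equiv.Perm.inv_eq_iff_eq, h']
  · rintro (rfl | rfl)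
    · rfl
    · exact permSubgraph_inv c

lemma Intercyclic4k.not_disjoint (hG : Intercyclic4k G) {c d : Equiv.Perm V}
    (hc : IsCyclePerm4k G c) (hd : IsCyclePerm4k G d) : ¬ c.Disjoint d := by
  intro hdis
  obtain ⟨u, p, hp, hp4, hpR⟩ := hc.exists_walk
  obtain ⟨v, q, hq, hq4, hqR⟩ := hd.exists_walk
  refine hG ⟨u, v, p, q, hp, hq, hp4, hq4, fun x hx hx' => ?_⟩
  rw [← Walk.mem_verts_toSubgraph, ← hpR] at hx
  rw [← Walk.mem_verts_toSubgraph, ← hqR] at hx'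
  exact (hdis x).elim hx hx'

end CyclePerm

section Counting

open Equiv.Perm

/-- The number of cycles of `σ` whose length is divisible by 4. -/
def cycleCount4k {V : Type*} [Fintype V] [DecidableEq V] (σ : Equiv.Perm V) : ℕ :=
  (σ.cycleFactorsFinset.filter fun c => 4 ∣ c.support.card).card

variable {V : Type*} [Fintype V] {G : SimpleGraph V}

lemma prod_charmatrix_adjMat [DecidableEq V] (σ : Equiv.Perm V) :
    ∏ v, (Matrix.charmatrix (adjMat ℝ G)) (σ v) v =
      if IsGraphPerm G σ then (-1) ^ σ.support.card * X ^ (Fintype.card V - σ.support.card)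
      else 0 := by
  split_ifs with h
  · rw [← Finset.prod_mul_prod_compl σ.support, ← Finset.card_compl, ← Finset.prod_const,
      ← Finset.prod_const]
    congr 1
    · refine Finset.prod_congr rfl fun v hv => ?_
      rw [Equiv.Perm.mem_support] at hv
      rw [Matrix.charmatrix_apply_ne _ _ _ hv, adjMat, if_pos ((h v).resolve_left hv).symm, C_1]
    · refine Finset.prod_congr rfl fun v hv => ?_
      rw [Finset.mem_compl, notMem_support] at hv
      rw [hv, Matrix.charmatrix_apply_eq, adjMat, if_neg G.irrefl, C_0, sub_zero]
  · simp only [IsGraphPerm, not_forall, not_or] at h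
    obtain ⟨v, hv, hv'⟩ := h
    refine Finset.prod_eq_zero (Finset.mem_univ v) ?_
    rw [Matrix.charmatrix_apply_ne _ _ _ hv, adjMat, if_neg fun h => hv' h.symm, C_0, neg_zero]

variable [DecidableEq V]

lemma IsGraphPerm.of_mem_cycleFactorsFinset {σ c : Equiv.Perm V} (h : IsGraphPerm G σ)
    (hc : c ∈ σ.cycleFactorsFinset) : IsGraphPerm G c := by
  intro v
  by_cases hv : c v = v
  · exact Or.inl hv
  · rw [(mem_cycleFactorsFinset_iff.1 hc).2 v (Equiv.Perm.mem_support.2 hv)]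
    exact h v

lemma IsGraphPerm.even_card_support_of_isCycle (hG : G.Colorable 2) {c : Equiv.Perm V}
    (h : IsGraphPerm G c) (hc : c.IsCycle) : Even c.support.card := by
  obtain ⟨χ⟩ := hG
  obtain ⟨v, hv, -⟩ := id hc
  have key : ∀ n : ℕ, χ ((c ^ n) v) = χ v ↔ Even n := by
    intro n
    induction n with
    | zero => simp
    | succ n ih =>
      have hne : c ((c ^ n) v) ≠ (c ^ n) v := by
        rw [← Equiv.Perm.mem_support, pow_apply_mem_support]
        simpa using hv
      have := χ.valid ((h ((c ^ n) v)).resolve_left hne)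
      rw [Nat.even_add_one, ← ih, pow_succ', mul_apply]
      generalize χ (c ((c ^ n) v)) = a at *
      generalize χ ((c ^ n) v) = b at *
      generalize χ v = d at *
      clear ih
      revert this
      revert a b d
      decide
  rw [← key, ← hc.orderOf, pow_orderOf_eq_one, one_apply]

lemma neg_one_pow_sum_add_card (s : Multiset ℕ) (hs : ∀ a ∈ s, Even a) :
    Even s.sum ∧ (-1 : ℝ) ^ (s.sum / 2) * (-1) ^ (s.sum + s.card) =
      (-1) ^ (s.filter (4 ∣ ·)).card := by
  induction s using Multiset.induction_on with
  | empty => simp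
  | cons a s ih =>
    obtain ⟨he, ih⟩ := ih fun b hb => hs b (Multiset.mem_cons_of_mem hb)
    obtain ⟨b, hb⟩ := hs a (Multiset.mem_cons_self a s)
    obtain ⟨t, ht⟩ := he
    rw [Multiset.sum_cons, Multiset.card_cons]
    refine ⟨by rw [hb, ht]; exact ⟨b + t, by ring⟩, ?_⟩
    have h1 : (a + s.sum) / 2 = b + s.sum / 2 := by omega
    have h2 : a + s.sum + (s.card + 1) = 2 * b + 1 + (s.sum + s.card) := by omega
    have h3 : (-1 : ℝ) ^ ((a + s.sum) / 2) * (-1) ^ (a + s.sum + (s.card + 1)) =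
        -(-1) ^ b * ((-1) ^ (s.sum / 2) * (-1) ^ (s.sum + s.card)) := by
      rw [h1, h2, pow_add, pow_add _ (2 * b + 1), pow_succ, pow_mul]
      ring
    rw [h3, ih]
    by_cases h4 : 4 ∣ a
    · have : Even b := by rw [even_iff_two_dvd]; omega
      rw [Multiset.filter_cons_of_pos _ h4, Multiset.card_cons, this.neg_one_pow]
      ring
    · have : Odd b := by rw [Nat.odd_iff]; omega
      rw [Multiset.filter_cons_of_neg _ h4, this.neg_one_pow]
      ring

lemma IsGraphPerm.even_and_sign (hG : G.Colorable 2) {σ : Equiv.Perm V} (h : IsGraphPerm G σ) :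
    Even σ.support.card ∧
      (-1 : ℝ) ^ (σ.support.card / 2) * ((sign σ : ℤ) : ℝ) = (-1) ^ cycleCount4k σ := by
  have := neg_one_pow_sum_add_card σ.cycleType (by
    intro a ha
    rw [cycleType_def, Multiset.mem_map] at ha
    obtain ⟨c, hc, rfl⟩ := ha
    exact (h.of_mem_cycleFactorsFinset hc).even_card_support_of_isCycle hG
      (mem_cycleFactorsFinset_iff.1 hc).1)
  rw [sum_cycleType] at this
  refine ⟨this.1, ?_⟩
  rw [sign_of_cycleType, sum_cycleType]
  push_cast
  rw [this.2, cycleType_def, Multiset.filter_map, Multiset.card_map]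
  rfl

lemma permPolyG_eq_sum (hG : G.Colorable 2) :
    permPolyG ℝ G = ∑ σ : Equiv.Perm V with IsGraphPerm G σ,
      X ^ (Fintype.card V - σ.support.card) := by
  rw [Finset.sum_filter]
  have : permPolyG ℝ G = ∑ σ : Equiv.Perm V, ∏ v, (Matrix.charmatrix (adjMat ℝ G)) (σ v) v := by
    unfold permPolyG Matrix.permanent
    congr!
  rw [this]
  refine Finset.sum_congr rfl fun σ _ => ?_
  rw [prod_charmatrix_adjMat]
  split_ifs with h
  · rw [(h.even_and_sign hG).1.neg_one_pow, one_mul]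
  · rfl

lemma charPolyG_eq_sum (hG : G.Colorable 2) :
    charPolyG ℝ G = ∑ σ : Equiv.Perm V with IsGraphPerm G σ,
      C ((sign σ : ℤ) : ℝ) * X ^ (Fintype.card V - σ.support.card) := by
  rw [Finset.sum_filter]
  have : charPolyG ℝ G = (Matrix.charmatrix (adjMat ℝ G)).det := by
    unfold charPolyG Matrix.charpoly
    congr!
  rw [this, Matrix.det_apply']
  refine Finset.sum_congr rfl fun σ _ => ?_
  rw [prod_charmatrix_adjMat]
  split_ifs with h
  · rw [(h.even_and_sign hG).1.neg_one_pow, one_mul]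
    simp
  · simp

lemma phiP_eq_sum (hG : G.Colorable 2) :
    phiP G = ∑ σ : Equiv.Perm V with IsGraphPerm G σ,
      (-1) ^ cycleCount4k σ * X ^ (Fintype.card V - σ.support.card) := by
  have hcoeff : ∀ i ∈ Finset.range (Fintype.card V + 1),
      (if Even i then C ((-1 : ℝ) ^ (i / 2) * (charPolyG ℝ G).coeff (Fintype.card V - i)) *
        X ^ (Fintype.card V - i) else 0) =
      ∑ σ : Equiv.Perm V with IsGraphPerm G σ, if i = σ.support.card then
        (-1) ^ cycleCount4k σ * X ^ (Fintype.card V - σ.support.card) else 0 := by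
    intro i hi
    rw [Finset.mem_range] at hi
    have hiff : ∀ σ : Equiv.Perm V,
        Fintype.card V - i = Fintype.card V - σ.support.card ↔ i = σ.support.card := by
      intro σ
      have := σ.support.card_le_univ
      omega
    split_ifs with he
    · rw [charPolyG_eq_sum hG, finsetSum_coeff, Finset.mul_sum, map_sum, Finset.sum_mul]
      refine Finset.sum_congr rfl fun σ hσ => ?_
      rw [coeff_C_mul, coeff_X_pow]
      simp only [hiff]
      split_ifs with h
      · rw [mul_one, h, ((Finset.mem_filter.1 hσ).2.even_and_sign hG).2]
        simp
      · simp
    · rw [Finset.sum_eq_zero]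
      intro σ hσ
      rw [if_neg]
      rintro rfl
      exact he ((Finset.mem_filter.1 hσ).2.even_and_sign hG).1
  rw [phiP, Finset.sum_congr rfl hcoeff, Finset.sum_comm]
  refine Finset.sum_congr rfl fun σ _ => ?_
  rw [Finset.sum_ite_eq', if_pos]
  have := σ.support.card_le_univ
  rw [Finset.mem_range]
  omega

lemma IsGraphPerm.isCyclePerm4k {σ c : Equiv.Perm V} (h : IsGraphPerm G σ)
    (hc : c ∈ σ.cycleFactorsFinset) (h4 : 4 ∣ c.support.card) : IsCyclePerm4k G c :=
  ⟨h.of_mem_cycleFactorsFinset hc, (mem_cycleFactorsFinset_iff.1 hc).1, h4⟩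

lemma Intercyclic4k.cycleCount4k_le_one (hG : Intercyclic4k G) {σ : Equiv.Perm V}
    (h : IsGraphPerm G σ) : cycleCount4k σ ≤ 1 := by
  rw [cycleCount4k, Finset.card_le_one]
  intro c hc d hd
  rw [Finset.mem_filter] at hc hd
  by_contra hne
  exact hG.not_disjoint (h.isCyclePerm4k hc.1 hc.2) (h.isCyclePerm4k hd.1 hd.2)
    (cycleFactorsFinset_pairwise_disjoint σ hc.1 hd.1 hne)

lemma card_support_ofSubtype {p : V → Prop} [DecidablePred p] [Fintype (Subtype p)]
    (τ : Equiv.Perm (Subtype p)) :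
    (ofSubtype τ).support.card = τ.support.card := by
  rw [← sum_cycleType, cycleType_ofSubtype, sum_cycleType]

/-- Deleting the vertices of a `4k`-cycle of a `4k`-intercyclic graph leaves no `4k`-cycle. -/
lemma Intercyclic4k.cycleCount4k_induce_eq_zero (hG : Intercyclic4k G) {c : Equiv.Perm V}
    (hc : IsCyclePerm4k G c) {s : Set V} [Fintype s] [DecidablePred (· ∈ s)] (hs : s = {v | c v = v})
    {τ : Equiv.Perm s} (h : IsGraphPerm (G.induce s) τ) : cycleCount4k τ = 0 := by
  rw [cycleCount4k, Finset.card_eq_zero, Finset.filter_eq_empty_iff]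
  intro d hd h4
  refine hG.not_disjoint hc (d := ofSubtype d) ⟨isGraphPerm_ofSubtype
    (h.of_mem_cycleFactorsFinset hd), ?_, ?_⟩ (disjoint_ofSubtype c s hs d)
  · rw [← card_cycleType_eq_one, cycleType_ofSubtype, card_cycleType_eq_one]
    exact (mem_cycleFactorsFinset_iff.1 hd).1
  · rwa [card_support_ofSubtype]

/-- Graph permutations having a given cycle `c` correspond to graph permutations of the graph
with the vertices of `c` deleted. -/
lemma sum_isGraphPerm_of_mem_cycleFactorsFinset {M : Type*} [AddCommMonoid M]
    {c : Equiv.Perm V} (hg : IsGraphPerm G c) (hc : c.IsCycle) {s : Set V}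
    [Fintype s] [DecidablePred (· ∈ s)] (hs : s = {v | c v = v}) (f : ℕ → M) :
    ∑ σ : Equiv.Perm V with IsGraphPerm G σ ∧ c ∈ σ.cycleFactorsFinset,
        f (Fintype.card V - σ.support.card) =
      ∑ τ : Equiv.Perm s with IsGraphPerm (G.induce s) τ,
        f (Fintype.card s - τ.support.card) := by
  have hmem : ∀ v, v ∈ s ↔ c v = v := fun v => by rw [hs]; rfl
  have hdis := disjoint_ofSubtype c s hs
  have hcard : Fintype.card V = Fintype.card s + c.support.card := by
    rw [← Finset.card_compl_add_card c.support, Fintype.card_of_subtype]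
    intro v
    rw [Finset.mem_compl, notMem_support]
    exact (hmem v).symm
  symm
  refine Finset.sum_bij (fun τ _ => c * ofSubtype τ) ?_ ?_ ?_ ?_
  · intro τ hτ
    rw [Finset.mem_filter] at hτ ⊢
    refine ⟨Finset.mem_univ _, fun v => ?_, ?_⟩
    · rcases hdis τ v with h | h
      · rw [(Equiv.Perm.Disjoint.commute (hdis τ)).eq]
        change ofSubtype τ (c v) = v ∨ G.Adj v (ofSubtype τ (c v))
        rw [h]
        exact isGraphPerm_ofSubtype hτ.2 v
      · rw [mul_apply, h]
        exact hg v
    · rw [mem_cycleFactorsFinset_iff]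
      refine ⟨hc, fun v hv => ?_⟩
      rw [mul_apply, ((hdis τ) v).resolve_left (Equiv.Perm.mem_support.1 hv)]
  · intro τ _ τ' _ h
    exact ofSubtype_injective (mul_left_cancel h)
  · intro σ hσ
    rw [Finset.mem_filter, mem_cycleFactorsFinset_iff] at hσ
    obtain ⟨-, hσ, -, hσc⟩ := hσ
    have hiff : ∀ v, σ v ∈ s ↔ v ∈ s := by
      have h1 : ∀ v, c v ≠ v → σ v = c v := fun v hv => (hσc v (Equiv.Perm.mem_support.2 hv)).symm
      intro v
      rw [hmem, hmem]
      constructor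
      · intro h
        by_contra hv
        rw [h1 v hv] at h
        exact hv (c.injective h)
      · intro h
        by_contra hv
        have hi : c (c⁻¹ (σ v)) = σ v := by simp
        have h2 : c (c⁻¹ (σ v)) ≠ c⁻¹ (σ v) := by
          intro h'
          apply hv
          rw [hi] at h'
          rwa [← h'] at hi
        have h3 := h1 _ h2
        rw [hi] at h3
        have h4 := σ.injective h3
        rw [h4] at h2
        exact h2 h
    refine ⟨σ.subtypePerm hiff, ?_, ?_⟩
    · rw [Finset.mem_filter]
      exact ⟨Finset.mem_univ _, fun v => (hσ v).imp (fun h => Subtype.ext h) id⟩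
    · ext v
      by_cases hv : v ∈ s
      · rw [mul_apply, ofSubtype_apply_of_mem _ hv, subtypePerm_apply]
        exact (hmem _).1 ((hiff v).2 hv)
      · rw [mul_apply, ofSubtype_apply_of_not_mem _ hv]
        exact hσc v (Equiv.Perm.mem_support.2 fun h => hv ((hmem v).2 h))
  · intro τ _
    rw [(hdis τ).card_support_mul, card_support_ofSubtype, hcard]
    congr 1
    omega

lemma phiP_induce_eq_sum (hG : G.Colorable 2) (hic : Intercyclic4k G) {c : Equiv.Perm V}
    (hc : IsCyclePerm4k G c) (s : Set V) [Fintype s] (hs : s = {v | c v = v}) :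
    phiP (G.induce s) = ∑ σ : Equiv.Perm V with IsGraphPerm G σ ∧ c ∈ σ.cycleFactorsFinset,
      X ^ (Fintype.card V - σ.support.card) := by
  have hG' : (G.induce s).Colorable 2 := hG.of_hom (Embedding.induce s).toHom
  rw [phiP_eq_sum hG', sum_isGraphPerm_of_mem_cycleFactorsFinset hc.1 hc.2.1 hs fun n => X ^ n]
  refine Finset.sum_congr (by congr!) fun τ hτ => ?_
  rw [hic.cycleCount4k_induce_eq_zero hc hs (Finset.mem_filter.1 hτ).2, pow_zero, one_mul]

lemma sum_isCyclePerm4k {M : Type*} [AddCommMonoid M] (f : G.Subgraph → M) :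
    ∑ c : Equiv.Perm V with IsCyclePerm4k G c, f (permSubgraph G c) =
      2 • ∑ᶠ R ∈ cycles4k G, f R := by
  have hfin : (cycles4k G).Finite := Set.toFinite _
  rw [finsum_mem_eq_finite_toFinset_sum _ hfin, Finset.smul_sum,
    ← Finset.sum_fiberwise_of_maps_to (g := permSubgraph G) (t := hfin.toFinset)]
  · refine Finset.sum_congr rfl fun R hR => ?_
    rw [hfin.mem_toFinset] at hR
    obtain ⟨v, w, hw, h4, rfl⟩ := hR
    obtain ⟨c, hc, hcR⟩ := exists_isCyclePerm4k_of_isCycle hw h4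
    rw [← hcR]
    have hset : ((Finset.univ.filter fun c => IsCyclePerm4k G c).filter fun d =>
        permSubgraph G d = permSubgraph G c) = {c, c⁻¹} := by
      ext d
      simp only [Finset.mem_filter, Finset.mem_univ, true_and, Finset.mem_insert,
        Finset.mem_singleton]
      constructor
      · rintro ⟨hd, h⟩
        exact (hc.permSubgraph_eq_iff hd).1 h
      · intro h
        have hd : IsCyclePerm4k G d := by
          rcases h with rfl | rfl
          exacts [hc, hc.inv]
        exact ⟨hd, (hc.permSubgraph_eq_iff hd).2 h⟩
    rw [hset, Finset.sum_pair hc.ne_inv, permSubgraph_inv, two_nsmul]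
  · intro c hc
    rw [hfin.mem_toFinset]
    exact (Finset.mem_filter.1 hc).2.exists_walk

lemma sum_cycleCount4k_smul {M : Type*} [AddCommMonoid M] (f : Equiv.Perm V → M) :
    ∑ σ : Equiv.Perm V with IsGraphPerm G σ, cycleCount4k σ • f σ =
      ∑ c : Equiv.Perm V with IsCyclePerm4k G c,
        ∑ σ : Equiv.Perm V with IsGraphPerm G σ ∧ c ∈ σ.cycleFactorsFinset, f σ := by
  simp_rw [cycleCount4k, ← Finset.sum_const]
  refine Finset.sum_comm' fun σ c => ?_
  simp only [Finset.mem_filter, Finset.mem_univ, true_and]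
  constructor
  · rintro ⟨h, hc, h4⟩
    exact ⟨⟨h, hc⟩, h.isCyclePerm4k hc h4⟩
  · rintro ⟨⟨h, hc⟩, hc'⟩
    exact ⟨h, hc, hc'.2.2⟩

end Counting

/-- main theorem. If `G` is a `4k`-intercyclic bipartite graph, then
`π(G,x) = φ_p(G,x) + 4 ∑_{R ∈ C_{4k}(G)} φ_p(G∖R, x)`, the sum being over all cycles `R`
of length divisible by 4, and `G∖R` being the induced subgraph on the complement of `V(R)`. -/
theorem stmt_3 {V : Type*} [Fintype V] (G : SimpleGraph V)
    (hbip : G.Colorable 2) (hic : Intercyclic4k G) :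
    permPolyG ℝ G = phiP G + 4 * ∑ᶠ R ∈ cycles4k G, phiP (G.induce (R.vertsᶜ)) := by
  have hinner : ∀ c ∈ (Finset.univ.filter fun c => IsCyclePerm4k G c),
      ∑ σ : Equiv.Perm V with IsGraphPerm G σ ∧ c ∈ σ.cycleFactorsFinset,
        (X : ℝ[X]) ^ (Fintype.card V - σ.support.card) =
      phiP (G.induce (permSubgraph G c).vertsᶜ) := by
    intro c hc
    refine (phiP_induce_eq_sum hbip hic (Finset.mem_filter.1 hc).2 _ ?_).symm
    ext v
    simp [permSubgraph]
  have hsum := sum_isCyclePerm4k (G := G) fun R => phiP (G.induce R.vertsᶜ)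
  rw [← Finset.sum_congr rfl hinner, ← sum_cycleCount4k_smul] at hsum
  have h4 : (4 : ℝ[X]) * ∑ᶠ R ∈ cycles4k G, phiP (G.induce R.vertsᶜ) =
      2 * (2 • ∑ᶠ R ∈ cycles4k G, phiP (G.induce R.vertsᶜ)) := by
    rw [two_nsmul]; ring
  rw [h4, ← hsum, permPolyG_eq_sum hbip, phiP_eq_sum hbip, Finset.mul_sum,
    ← Finset.sum_add_distrib]
  refine Finset.sum_congr rfl fun σ hσ => ?_
  have hle := hic.cycleCount4k_le_one (Finset.mem_filter.1 hσ).2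
  interval_cases cycleCount4k σ
  · simp
  · rw [one_smul]; ring

end
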